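/- arXiv:2206.04993 — 3 statements merged into one kernel-verified Lean document; each statement's English description precedes it below -/
import Mathlib

section
/- Let C be a d×d real symmetric positive definite matrix with condition number κ = λ_max(C)/λ_min(C), and let C^{1/2} be its symmetric positive definite square root. If u and v are unit vectors in ℝ^d with ⟨u, v⟩ = 0, then the angle θ between C^{1/2}u and C^{1/2}v, defined by |θ| = arccos( |⟨C^{1/2}u, C^{1/2}v⟩| / (‖C^{1/2}u‖ ‖C^{1/2}v‖) ), satisfies |θ| > (1/8)(1+κ)^{−5/4} radians. -/
open Matrix

section

variable {n : Type*} [Fintype n]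

/-- The Cauchy–Schwarz inequality for the form of a real positive semidefinite matrix. -/
theorem Matrix.PosSemidef.sq_dotProduct_mulVec_le {B : Matrix n n ℝ} (hB : B.PosSemidef)
    (x y : n → ℝ) : (x ⬝ᵥ B *ᵥ y) ^ 2 ≤ (x ⬝ᵥ B *ᵥ x) * (y ⬝ᵥ B *ᵥ y) := by
  have hsymm : y ⬝ᵥ B *ᵥ x = x ⬝ᵥ B *ᵥ y := by
    have hT : Bᵀ = B := by simpa using hB.1.eq
    rw [dotProduct_mulVec, ← mulVec_transpose, hT, dotProduct_comm]
  have hdisc : discrim (y ⬝ᵥ B *ᵥ y) (2 * (x ⬝ᵥ B *ᵥ y)) (x ⬝ᵥ B *ᵥ x) ≤ 0 := by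
    refine discrim_le_zero fun t => ?_
    have h := hB.dotProduct_mulVec_nonneg (x + t • y)
    simp only [star_trivial, mulVec_add, mulVec_smul, dotProduct_add, add_dotProduct,
      dotProduct_smul, smul_dotProduct, smul_eq_mul, hsymm] at h
    linarith
  rw [discrim] at hdisc
  linarith

variable [DecidableEq n]

theorem Matrix.IsHermitian.posSemidef_sub_algebraMap {A : Matrix n n ℝ} (hA : A.IsHermitian)
    {m : ℝ} (hm : ∀ i, m ≤ hA.eigenvalues i) :
    (A - algebraMap ℝ (Matrix n n ℝ) m).PosSemidef := by
  have hH : (A - algebraMap ℝ (Matrix n n ℝ) m).IsHermitian :=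
    hA.sub (by simp [algebraMap_eq_diagonal, IsHermitian, diagonal_transpose])
  rw [hH.posSemidef_iff_eigenvalues_nonneg]
  intro i
  have h := hH.eigenvalues_mem_spectrum_real i
  rw [← spectrum.sub_singleton_eq, hA.spectrum_real_eq_range_eigenvalues] at h
  obtain ⟨_, ⟨j, rfl⟩, _, rfl, h⟩ := h
  simpa [← h] using hm j

theorem Matrix.IsHermitian.posSemidef_algebraMap_sub {A : Matrix n n ℝ} (hA : A.IsHermitian)
    {M : ℝ} (hM : ∀ i, hA.eigenvalues i ≤ M) :
    (algebraMap ℝ (Matrix n n ℝ) M - A).PosSemidef := by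
  have hH : (algebraMap ℝ (Matrix n n ℝ) M - A).IsHermitian :=
    IsHermitian.sub (by simp [algebraMap_eq_diagonal, IsHermitian, diagonal_transpose]) hA
  rw [hH.posSemidef_iff_eigenvalues_nonneg]
  intro i
  have h := hH.eigenvalues_mem_spectrum_real i
  rw [← spectrum.singleton_sub_eq, hA.spectrum_real_eq_range_eigenvalues] at h
  obtain ⟨_, rfl, _, ⟨j, rfl⟩, h⟩ := h
  simpa [← h] using hM j

theorem Matrix.dotProduct_algebraMap_mulVec (m : ℝ) (x y : n → ℝ) :
    x ⬝ᵥ (algebraMap ℝ (Matrix n n ℝ) m) *ᵥ y = m * (x ⬝ᵥ y) := by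
  simp [Algebra.algebraMap_eq_smul_one, smul_mulVec]

/-- A weak form of Wielandt's inequality. -/
theorem Matrix.IsHermitian.abs_dotProduct_mulVec_le {C : Matrix n n ℝ} (hC : C.IsHermitian)
    {m M : ℝ} (hm : 0 < m) (hmC : ∀ i, m ≤ hC.eigenvalues i) (hCM : ∀ i, hC.eigenvalues i ≤ M)
    {u v : n → ℝ} (hu : u ⬝ᵥ u = 1) (hv : v ⬝ᵥ v = 1) (huv : u ⬝ᵥ v = 0) :
    |u ⬝ᵥ C *ᵥ v| ≤ (1 - m / M) * √((u ⬝ᵥ C *ᵥ u) * (v ⬝ᵥ C *ᵥ v)) := by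
  have hlow := hC.posSemidef_sub_algebraMap hmC
  have hup := hC.posSemidef_algebraMap_sub hCM
  have hcs := hlow.sq_dotProduct_mulVec_le u v
  have hu1 := hlow.dotProduct_mulVec_nonneg u
  have hv1 := hlow.dotProduct_mulVec_nonneg v
  have hu2 := hup.dotProduct_mulVec_nonneg u
  have hv2 := hup.dotProduct_mulVec_nonneg v
  simp only [star_trivial, sub_mulVec, dotProduct_sub, dotProduct_algebraMap_mulVec, hu, hv, huv,
    mul_one, mul_zero, sub_zero] at hcs hu1 hv1 hu2 hv2
  set a := u ⬝ᵥ C *ᵥ u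
  set b := v ⬝ᵥ C *ᵥ v
  have hM : 0 < M := by linarith
  have hr : 0 ≤ 1 - m / M := by
    rw [sub_nonneg, div_le_one hM]; linarith
  have shrink : ∀ x ≤ M, x - m ≤ (1 - m / M) * x := fun x hx => by
    have : m / M * x ≤ m := by
      rw [div_mul_eq_mul_div, div_le_iff₀ hM]
      exact mul_le_mul_of_nonneg_left hx hm.le
    linarith
  refine abs_le_of_sq_le_sq ?_ (by positivity)
  rw [mul_pow, Real.sq_sqrt (mul_nonneg (by linarith) (by linarith))]
  calc _ ≤ (a - m) * (b - m) := hcs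
    _ ≤ ((1 - m / M) * a) * ((1 - m / M) * b) :=
      mul_le_mul (shrink a (by linarith)) (shrink b (by linarith)) hv1
        (mul_nonneg hr (by linarith))
    _ = _ := by ring

end

theorem Real.lt_arccos_of_lt_cos {t x : ℝ} (ht0 : 0 ≤ t) (htπ : t ≤ Real.pi) (hx : -1 ≤ x)
    (h : x < cos t) : t < arccos x := by
  simpa only [arccos_cos ht0 htπ] using arccos_lt_arccos hx h (cos_le_one t)





/-- **Angle between orthonormal vectors under a positive definite metric.**
If `C` is symmetric positive definite with condition number `κ`, `C^{1/2}` its symmetric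
positive definite square root, and `u ⊥ v` are unit vectors, then the angle
`θ = arccos(|⟨C^{1/2}u, C^{1/2}v⟩| / (‖C^{1/2}u‖‖C^{1/2}v‖))` satisfies
`θ > (1/8)(1+κ)^{−5/4}`. -/
theorem angle_lower_bound_of_orthonormal {d : ℕ}
    (C S : Matrix (Fin d) (Fin d) ℝ) (hC : C.PosDef) (hS : S.PosDef) (hSsq : S * S = C)
    (lmax lmin κ : ℝ)
    (hmax : IsGreatest (Set.range hC.1.eigenvalues) lmax)
    (hmin : IsLeast (Set.range hC.1.eigenvalues) lmin)
    (hκ : κ = lmax / lmin)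
    (u v : Fin d → ℝ) (hu : u ⬝ᵥ u = 1) (hv : v ⬝ᵥ v = 1) (huv : u ⬝ᵥ v = 0) :
    (1 / 8 : ℝ) * (1 + κ) ^ (-(5 / 4) : ℝ) <
      Real.arccos (|S.mulVec u ⬝ᵥ S.mulVec v| /
        (Real.sqrt (S.mulVec u ⬝ᵥ S.mulVec u) * Real.sqrt (S.mulVec v ⬝ᵥ S.mulVec v))) := by
  have hm : 0 < lmin := by
    obtain ⟨i, hi⟩ := hmin.1
    exact hi ▸ hC.eigenvalues_pos i
  have hle : lmin ≤ lmax := hmin.2 hmax.1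
  have hM : 0 < lmax := hm.trans_le hle
  have hκ1 : 1 ≤ κ := by rwa [hκ, one_le_div hm]
  have hdot : ∀ x y, S *ᵥ x ⬝ᵥ S *ᵥ y = x ⬝ᵥ C *ᵥ y := fun x y => by
    have hT : Sᵀ = S := by simpa using hS.1.eq
    rw [← hSsq, ← mulVec_mulVec, dotProduct_mulVec x, ← mulVec_transpose, hT]
  have hpos : ∀ x : Fin d → ℝ, x ⬝ᵥ x = 1 → 0 < x ⬝ᵥ C *ᵥ x := fun x hx => by
    have h := hC.dotProduct_mulVec_pos (x := x) (by rintro rfl; simp at hx)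
    simpa using h
  have hW := hC.1.abs_dotProduct_mulVec_le hm (fun i => hmin.2 ⟨i, rfl⟩)
    (fun i => hmax.2 ⟨i, rfl⟩) hu hv huv
  simp only [hdot]
  have ha := hpos u hu
  have hb := hpos v hv
  rw [← Real.sqrt_mul ha.le]
  have hcos : |u ⬝ᵥ C *ᵥ v| / √((u ⬝ᵥ C *ᵥ u) * (v ⬝ᵥ C *ᵥ v)) ≤ 1 - κ⁻¹ := by
    rw [div_le_iff₀ (by positivity), hκ, inv_div]
    exact hW
  set t : ℝ := (1 / 8 : ℝ) * (1 + κ) ^ (-(5 / 4) : ℝ)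
  have ht0 : 0 ≤ t := by positivity
  have ht1 : t ≤ 1 := by
    have : (1 + κ) ^ (-(5 / 4) : ℝ) ≤ 1 :=
      Real.rpow_le_one_of_one_le_of_nonpos (by linarith) (by norm_num)
    simp only [t]
    linarith
  have htsq : t ^ 2 ≤ (1 + κ)⁻¹ := by
    have h : ((1 + κ) ^ (-(5 / 4) : ℝ)) ^ 2 ≤ (1 + κ)⁻¹ := by
      rw [← Real.rpow_natCast, ← Real.rpow_mul (by linarith), ← Real.rpow_neg_one]
      exact Real.rpow_le_rpow_of_exponent_le (by linarith) (by norm_num)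
    have : 0 ≤ (1 + κ)⁻¹ := by positivity
    simp only [t, mul_pow]
    linarith
  have hinv : (1 + κ)⁻¹ < κ⁻¹ := inv_strictAnti₀ (by linarith) (by linarith)
  have : 0 < (1 + κ)⁻¹ := by positivity
  have hnonneg : 0 ≤ |u ⬝ᵥ C *ᵥ v| / √((u ⬝ᵥ C *ᵥ u) * (v ⬝ᵥ C *ᵥ v)) := by positivity
  refine Real.lt_arccos_of_lt_cos ht0 (by linarith [Real.pi_gt_three]) (by linarith) ?_
  linarith [Real.one_sub_sq_div_two_le_cos (x := t)]
end

section
/- Let C be a d×d real symmetric positive definite matrix with condition number κ = λ_max(C)/λ_min(C), and let C^{1/2} be its symmetric positive definite square root. Let ε satisfy 0 < ε < min(1/κ, 1/2), and let u, v be unit vectors in ℝ^d with ⟨u, v⟩ ≥ √(1 − ε²) (so their angle is O(ε)). Then the angle θ between C^{1/2}u and C^{1/2}v, defined by |θ| = arccos( |⟨C^{1/2}u, C^{1/2}v⟩| / (‖C^{1/2}u‖ ‖C^{1/2}v‖) ), satisfies |θ| ≤ 4 √( (1+κ)√κ · ε + (κ²/4 + 1) ε² ); in particular an O(ε) angle is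 blown up to at most O(κ^{3/4} ε^{1/2}). -/
open Matrix

/-- The quadratic form of a real symmetric matrix in coordinates of its eigenvector basis. -/
theorem Matrix.IsHermitian.dotProduct_mulVec_eq_sum_eigenvalues {n : Type*} [Fintype n]
    [DecidableEq n] {A : Matrix n n ℝ} (hA : A.IsHermitian) (x : n → ℝ) :
    x ⬝ᵥ A *ᵥ x = ∑ i, hA.eigenvalues i * (x ⬝ᵥ ⇑(hA.eigenvectorBasis i)) ^ 2 := by
  have hT : Aᵀ = A := by simpa using hA.eq
  have h := hA.eigenvectorBasis.sum_inner_mul_inner (WithLp.toLp 2 x) (WithLp.toLp 2 (A *ᵥ x))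
  simp only [EuclideanSpace.inner_eq_star_dotProduct, star_trivial] at h
  rw [dotProduct_comm, ← h]
  refine Finset.sum_congr rfl fun i _ => ?_
  have h' : (A *ᵥ x) ⬝ᵥ ⇑(hA.eigenvectorBasis i)
      = hA.eigenvalues i * (x ⬝ᵥ ⇑(hA.eigenvectorBasis i)) := by
    rw [dotProduct_comm, dotProduct_mulVec, ← mulVec_transpose, hT, hA.mulVec_eigenvectorBasis,
      smul_dotProduct, smul_eq_mul, dotProduct_comm]
  rw [h', dotProduct_comm _ x]
  ring

theorem Matrix.IsHermitian.sum_sq_dotProduct_eigenvectorBasis {n : Type*} [Fintype n]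
    [DecidableEq n] {A : Matrix n n ℝ} (hA : A.IsHermitian) (x : n → ℝ) :
    ∑ i, (x ⬝ᵥ ⇑(hA.eigenvectorBasis i)) ^ 2 = x ⬝ᵥ x := by
  have h := hA.eigenvectorBasis.sum_inner_mul_inner (WithLp.toLp 2 x) (WithLp.toLp 2 x)
  simp only [EuclideanSpace.inner_eq_star_dotProduct, star_trivial] at h
  rw [← h]
  exact Finset.sum_congr rfl fun i _ => by rw [dotProduct_comm _ x, sq]

theorem Matrix.IsHermitian.dotProduct_mulVec_le {n : Type*} [Fintype n]
    [DecidableEq n] {A : Matrix n n ℝ} (hA : A.IsHermitian) {l : ℝ}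
    (hl : ∀ i, hA.eigenvalues i ≤ l) (x : n → ℝ) : x ⬝ᵥ A *ᵥ x ≤ l * (x ⬝ᵥ x) := by
  rw [hA.dotProduct_mulVec_eq_sum_eigenvalues, ← hA.sum_sq_dotProduct_eigenvectorBasis,
    Finset.mul_sum]
  exact Finset.sum_le_sum fun i _ => mul_le_mul_of_nonneg_right (hl i) (sq_nonneg _)

theorem Matrix.IsHermitian.le_dotProduct_mulVec {n : Type*} [Fintype n]
    [DecidableEq n] {A : Matrix n n ℝ} (hA : A.IsHermitian) {l : ℝ}
    (hl : ∀ i, l ≤ hA.eigenvalues i) (x : n → ℝ) : l * (x ⬝ᵥ x) ≤ x ⬝ᵥ A *ᵥ x := by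
  rw [hA.dotProduct_mulVec_eq_sum_eigenvalues, ← hA.sum_sq_dotProduct_eigenvectorBasis,
    Finset.mul_sum]
  exact Finset.sum_le_sum fun i _ => mul_le_mul_of_nonneg_right (hl i) (sq_nonneg _)

theorem Real.arccos_le_mul_sqrt_one_sub_sq {x : ℝ} (hx : 0 ≤ x) :
    Real.arccos x ≤ Real.pi / 2 * Real.sqrt (1 - x ^ 2) := by
  have h := Real.mul_le_sin (Real.arccos_nonneg x) (Real.arccos_le_pi_div_two.2 hx)
  rw [Real.sin_arccos] at h
  have hpi := Real.pi_pos
  calc Real.arccos x = Real.pi / 2 * (2 / Real.pi * Real.arccos x) := by field_simp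
    _ ≤ _ := by gcongr

/-- **Angle blow-up for nearly parallel vectors under a positive definite metric.**
If `C` is symmetric positive definite with condition number `κ`, `C^{1/2}` its symmetric
positive definite square root, `0 < ε < min(1/κ, 1/2)`, and `u, v` are unit vectors with
`⟨u, v⟩ ≥ √(1 − ε²)`, then the angle between `C^{1/2}u` and `C^{1/2}v` is at most
`4·√((1+κ)·√κ·ε + (κ²/4 + 1)·ε²)`, i.e. `O(κ^{3/4} ε^{1/2})`. -/
theorem angle_upper_bound_of_nearly_parallel {d : ℕ}
    (C S : Matrix (Fin d) (Fin d) ℝ) (hC : C.PosDef) (hS : S.PosDef) (hSsq : S * S = C)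
    (lmax lmin κ : ℝ)
    (hmax : IsGreatest (Set.range hC.1.eigenvalues) lmax)
    (hmin : IsLeast (Set.range hC.1.eigenvalues) lmin)
    (hκ : κ = lmax / lmin)
    (ε : ℝ) (hε0 : 0 < ε) (hεκ : ε < min (1 / κ) (1 / 2))
    (u v : Fin d → ℝ) (hu : u ⬝ᵥ u = 1) (hv : v ⬝ᵥ v = 1)
    (huv : Real.sqrt (1 - ε ^ 2) ≤ u ⬝ᵥ v) :
    Real.arccos (|S.mulVec u ⬝ᵥ S.mulVec v| /
        (Real.sqrt (S.mulVec u ⬝ᵥ S.mulVec u) * Real.sqrt (S.mulVec v ⬝ᵥ S.mulVec v)))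
      ≤ 4 * Real.sqrt ((1 + κ) * Real.sqrt κ * ε + (κ ^ 2 / 4 + 1) * ε ^ 2) := by
  have hmax' : ∀ i, hC.1.eigenvalues i ≤ lmax := fun i => hmax.2 ⟨i, rfl⟩
  have hmin' : ∀ i, lmin ≤ hC.1.eigenvalues i := fun i => hmin.2 ⟨i, rfl⟩
  have hlmin : 0 < lmin := by
    obtain ⟨i, hi⟩ := hmin.1
    exact hi ▸ hC.eigenvalues_pos i
  have hlmax : 0 < lmax := by
    obtain ⟨i, hi⟩ := hmax.1
    exact hi ▸ hC.eigenvalues_pos i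
  have hκ0 : 0 < κ := hκ ▸ div_pos hlmax hlmin
  have hε : ε < 1 / 2 := hεκ.trans_le (min_le_right _ _)
  have hST : Sᵀ = S := by simpa using hS.1.eq
  have hquad (x : Fin d → ℝ) : S *ᵥ x ⬝ᵥ S *ᵥ x = x ⬝ᵥ C *ᵥ x := by
    rw [← hSsq, ← mulVec_mulVec, dotProduct_mulVec x, ← mulVec_transpose, hST]
  set a := S *ᵥ u ⬝ᵥ S *ᵥ u with ha
  set b := S *ᵥ v ⬝ᵥ S *ᵥ v with hb
  set c := S *ᵥ u ⬝ᵥ S *ᵥ v with hc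
  set t := u ⬝ᵥ v with ht
  have ha_lb : lmin ≤ a := by
    rw [ha, hquad]; simpa [hu] using hC.1.le_dotProduct_mulVec hmin' u
  have hb_lb : lmin ≤ b := by
    rw [hb, hquad]; simpa [hv] using hC.1.le_dotProduct_mulVec hmin' v
  have ha0 : 0 < a := hlmin.trans_le ha_lb
  have hb0 : 0 < b := hlmin.trans_le hb_lb
  have ht_sq : 1 - t ^ 2 ≤ ε ^ 2 := by
    have h1 : 0 ≤ 1 - ε ^ 2 := by nlinarith
    have h2 := pow_le_pow_left₀ (Real.sqrt_nonneg _) huv 2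
    rw [Real.sq_sqrt h1] at h2
    linarith
  -- Remove from `v` its component along `u`; the Gram determinant is unchanged.
  have hresid : b - 2 * t * c + t ^ 2 * a ≤ lmax * ε ^ 2 := by
    have h := hC.1.dotProduct_mulVec_le hmax' (v - t • u)
    have h1 : (v - t • u) ⬝ᵥ (v - t • u) = 1 - t ^ 2 := by
      simp only [sub_dotProduct, dotProduct_sub, smul_dotProduct, dotProduct_smul, smul_eq_mul,
        hu, hv, dotProduct_comm v u, ← ht]
      ring
    have h2 : S *ᵥ (v - t • u) ⬝ᵥ S *ᵥ (v - t • u) = b - 2 * t * c + t ^ 2 * a := by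
      simp only [mulVec_sub, mulVec_smul, sub_dotProduct, dotProduct_sub, smul_dotProduct,
        dotProduct_smul, smul_eq_mul, dotProduct_comm (S *ᵥ v) (S *ᵥ u), ← ha, ← hb, ← hc]
      ring
    rw [← hquad, h1, h2] at h
    exact h.trans (mul_le_mul_of_nonneg_left ht_sq hlmax.le)
  have hlmax_le : lmax ≤ κ * b := by
    have : lmax = κ * lmin := by rw [hκ]; field_simp
    rw [this]
    gcongr
  have hgram : a * b - c ^ 2 ≤ a * b * (κ * ε ^ 2) := by
    calc a * b - c ^ 2 ≤ a * (b - 2 * t * c + t ^ 2 * a) := by nlinarith [sq_nonneg (c - t * a)]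
      _ ≤ a * (κ * b * ε ^ 2) := by
        gcongr
        exact hresid.trans (by gcongr)
      _ = a * b * (κ * ε ^ 2) := by ring
  have hcos : 1 - (|c| / (Real.sqrt a * Real.sqrt b)) ^ 2 ≤ κ * ε ^ 2 := by
    rw [div_pow, mul_pow, sq_abs, Real.sq_sqrt ha0.le, Real.sq_sqrt hb0.le, sub_le_comm,
      le_div_iff₀ (mul_pos ha0 hb0)]
    linarith
  calc _ ≤ Real.pi / 2 * Real.sqrt (1 - (|c| / (Real.sqrt a * Real.sqrt b)) ^ 2) :=
        Real.arccos_le_mul_sqrt_one_sub_sq (by positivity)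
    _ ≤ 4 * Real.sqrt ((1 + κ) * Real.sqrt κ * ε + (κ ^ 2 / 4 + 1) * ε ^ 2) := by
      gcongr
      · linarith [Real.pi_le_four]
      · have h1 : 0 ≤ (1 + κ) * Real.sqrt κ * ε := by positivity
        have h2 : 0 ≤ (κ / 2 - 1) ^ 2 * ε ^ 2 := by positivity
        linarith
end

section
/- Let B be a d×d real symmetric positive definite matrix with λ_max(B) ≥ 1 and condition number κ = λ_max(B)/λ_min(B). Let v ∈ ℝ^d be a unit vector, and let w, q ∈ ℝ^d with ‖w‖ ≤ ε and ‖q‖ ≤ ε for some ε > 0. Set v̂ = v + w and b̂ = B(v + w) + q, and let 0 < ρ ≤ ⟨v, B v⟩(1 − 3κε − 2κε²). Then the clipped inner product max(⟨v̂, b̂⟩, ρ) lies in the interval [⟨v, B v⟩(1 − 3κε − 2κε²), ⟨v, B v⟩(1 + 3κε + 2κε²)]. -/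
open Matrix

/-- If all eigenvalues of a real symmetric matrix lie in `[l, u]`, then so does its Rayleigh
quotient. -/
theorem Matrix.IsHermitian.quadraticForm_mem_Icc {n : Type*} [Fintype n] [DecidableEq n]
    {A : Matrix n n ℝ} (hA : A.IsHermitian) {l u : ℝ} (h : ∀ i, hA.eigenvalues i ∈ Set.Icc l u)
    (x : n → ℝ) : x ⬝ᵥ A *ᵥ x ∈ Set.Icc (l * (x ⬝ᵥ x)) (u * (x ⬝ᵥ x)) := by
  open scoped MatrixOrder in
  have hl : algebraMap ℝ (Matrix n n ℝ) l ≤ A := by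
    rw [algebraMap_le_iff_le_spectrum (a := A) hA.isSelfAdjoint,
      hA.spectrum_real_eq_range_eigenvalues]
    rintro _ ⟨i, rfl⟩
    exact (h i).1
  open scoped MatrixOrder in
  have hu : A ≤ algebraMap ℝ (Matrix n n ℝ) u := by
    rw [le_algebraMap_iff_spectrum_le (a := A) hA.isSelfAdjoint,
      hA.spectrum_real_eq_range_eigenvalues]
    rintro _ ⟨i, rfl⟩
    exact (h i).2
  have hl' := (Matrix.le_iff.1 hl).dotProduct_mulVec_nonneg x
  have hu' := (Matrix.le_iff.1 hu).dotProduct_mulVec_nonneg x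
  simp only [Algebra.algebraMap_eq_smul_one, sub_mulVec, smul_mulVec, one_mulVec,
    dotProduct_sub, dotProduct_smul, star_trivial, smul_eq_mul, sub_nonneg] at hl' hu'
  exact ⟨hl', hu'⟩

theorem Matrix.IsHermitian.dotProduct_mulVec_comm {n : Type*} [Fintype n]
    {A : Matrix n n ℝ} (hA : A.IsHermitian) (x y : n → ℝ) : x ⬝ᵥ A *ᵥ y = y ⬝ᵥ A *ᵥ x := by
  have hT : Aᵀ = A := by simpa using hA.eq
  rw [dotProduct_comm, dotProduct_mulVec, ← mulVec_transpose, hT]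

/-- Polarized form of an upper bound on a positive semidefinite quadratic form. -/
theorem Matrix.PosSemidef.abs_dotProduct_mulVec_le {n : Type*} [Fintype n]
    {A : Matrix n n ℝ} (hA : A.PosSemidef) {x y : n → ℝ} {M ε : ℝ} (hε : 0 < ε)
    (hx : x ⬝ᵥ A *ᵥ x ≤ M) (hy : y ⬝ᵥ A *ᵥ y ≤ M * ε ^ 2) : |x ⬝ᵥ A *ᵥ y| ≤ M * ε := by
  have hsub := hA.dotProduct_mulVec_nonneg (ε • x - y)
  have hadd := hA.dotProduct_mulVec_nonneg (ε • x + y)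
  simp only [star_trivial, mulVec_sub, mulVec_add, mulVec_smul, dotProduct_sub, dotProduct_add,
    sub_dotProduct, add_dotProduct, smul_dotProduct, dotProduct_smul, smul_eq_mul,
    hA.1.dotProduct_mulVec_comm y x]
    at hsub hadd
  have hx' := mul_le_mul_of_nonneg_left hx (sq_nonneg ε)
  rw [abs_le]
  constructor <;> refine le_of_mul_le_mul_left ?_ hε <;> linarith

/-- Cauchy–Schwarz for the dot product, with bounds on the two squared lengths. -/
theorem abs_dotProduct_le_of_dotProduct_self_le {n : Type*} [Fintype n] [DecidableEq n]
    {x y : n → ℝ} {M ε : ℝ} (hε : 0 < ε) (hx : x ⬝ᵥ x ≤ M) (hy : y ⬝ᵥ y ≤ M * ε ^ 2) :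
    |x ⬝ᵥ y| ≤ M * ε := by
  simpa using (PosSemidef.one (n := n) (R := ℝ)).abs_dotProduct_mulVec_le (x := x) (y := y) hε
    (by simpa using hx) (by simpa using hy)

/-- **Perturbation bound for the clipped denominator term.**
Let `B` be symmetric positive definite with `λ_max(B) ≥ 1` and condition number `κ`,
`v` a unit vector, `‖w‖ ≤ ε`, `‖q‖ ≤ ε`, `v̂ = v + w`, `b̂ = B(v + w) + q`, and
`0 < ρ ≤ ⟨v, B v⟩(1 − 3κε − 2κε²)`.  Then the clipped inner product `max(⟨v̂, b̂⟩, ρ)`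
lies in `[⟨v, B v⟩(1 − 3κε − 2κε²), ⟨v, B v⟩(1 + 3κε + 2κε²)]`. -/
theorem clipped_inner_product_bound {d : ℕ}
    (B : Matrix (Fin d) (Fin d) ℝ) (hB : B.PosDef)
    (lmax lmin κ : ℝ)
    (hmax : IsGreatest (Set.range hB.1.eigenvalues) lmax)
    (hmin : IsLeast (Set.range hB.1.eigenvalues) lmin)
    (hκ : κ = lmax / lmin) (hlmax1 : 1 ≤ lmax)
    (v : Fin d → ℝ) (hv : v ⬝ᵥ v = 1)
    (ε : ℝ) (hε : 0 < ε)
    (w q : Fin d → ℝ)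
    (hw : Real.sqrt (w ⬝ᵥ w) ≤ ε) (hq : Real.sqrt (q ⬝ᵥ q) ≤ ε)
    (vhat bhat : Fin d → ℝ)
    (hvhat : vhat = v + w) (hbhat : bhat = B.mulVec (v + w) + q)
    (ρ : ℝ) (hρ0 : 0 < ρ)
    (hρ : ρ ≤ (v ⬝ᵥ B.mulVec v) * (1 - 3 * κ * ε - 2 * κ * ε ^ 2)) :
    max (vhat ⬝ᵥ bhat) ρ ∈
      Set.Icc ((v ⬝ᵥ B.mulVec v) * (1 - 3 * κ * ε - 2 * κ * ε ^ 2))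
              ((v ⬝ᵥ B.mulVec v) * (1 + 3 * κ * ε + 2 * κ * ε ^ 2)) := by
  have hbd := hB.1.quadraticForm_mem_Icc (l := lmin) (u := lmax)
    fun i => ⟨hmin.2 ⟨i, rfl⟩, hmax.2 ⟨i, rfl⟩⟩
  have hlmin : 0 < lmin := by
    obtain ⟨i, rfl⟩ := hmin.1
    exact hB.eigenvalues_pos i
  have hww : w ⬝ᵥ w ≤ ε ^ 2 := (Real.sqrt_le_left hε.le).1 hw
  have hqq : q ⬝ᵥ q ≤ ε ^ 2 := (Real.sqrt_le_left hε.le).1 hq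
  have hvBv := hbd v
  rw [hv, mul_one, mul_one] at hvBv
  have hwBw : w ⬝ᵥ B *ᵥ w ≤ lmax * ε ^ 2 :=
    (hbd w).2.trans (mul_le_mul_of_nonneg_left hww (by linarith))
  have hwBw0 : 0 ≤ w ⬝ᵥ B *ᵥ w := by simpa using hB.posSemidef.dotProduct_mulVec_nonneg w
  have hvBw := abs_le.1 (hB.posSemidef.abs_dotProduct_mulVec_le hε hvBv.2 hwBw)
  have hvq := abs_le.1 (abs_dotProduct_le_of_dotProduct_self_le (M := 1) hε hv.le (by simpa))
  have hwq : |w ⬝ᵥ q| ≤ ε ^ 2 := by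
    simpa using abs_dotProduct_le_of_dotProduct_self_le (M := ε ^ 2) one_pos hww (by simpa)
  rw [abs_le] at hwq
  have hexp : vhat ⬝ᵥ bhat =
      v ⬝ᵥ B *ᵥ v + 2 * (v ⬝ᵥ B *ᵥ w) + w ⬝ᵥ B *ᵥ w + v ⬝ᵥ q + w ⬝ᵥ q := by
    rw [hvhat, hbhat]
    simp only [mulVec_add, dotProduct_add, add_dotProduct, hB.1.dotProduct_mulVec_comm w v]
    ring
  have hlmax : lmax ≤ (v ⬝ᵥ B *ᵥ v) * κ := by
    rw [hκ, ← mul_div_assoc, le_div_iff₀ hlmin, mul_comm]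
    exact mul_le_mul_of_nonneg_right hvBv.1 (by linarith)
  have hlin : lmax * ε ≤ (v ⬝ᵥ B *ᵥ v) * κ * ε := mul_le_mul_of_nonneg_right hlmax hε.le
  have hquad : lmax * ε ^ 2 ≤ (v ⬝ᵥ B *ᵥ v) * κ * ε ^ 2 :=
    mul_le_mul_of_nonneg_right hlmax (sq_nonneg ε)
  have hε1 : ε ≤ lmax * ε := le_mul_of_one_le_left hε.le hlmax1
  have hε2 : ε ^ 2 ≤ lmax * ε ^ 2 := le_mul_of_one_le_left (sq_nonneg ε) hlmax1
  refine ⟨le_max_of_le_left ?_, max_le ?_ (hρ.trans ?_)⟩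
  · linarith
  · linarith
  · nlinarith
end
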